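/- Hardware-quality scaling law, convergent case (Corollary 1): in the asymptotic setting with z_t = 0, 0 < z_r < 1/2, and κ_{t0} < 1, for every UE index k the quantity C_k(M)/(κ_{t0} A_k(M)) − 1 is strictly positive for every M, and the difference R_k(M) − log₂( 1 + ( C_k(M)/(κ_{t0} A_k(M)) − 1 )^{−1} ) converges to 0 as M → ∞; that is, asymptotically the spectral efficiency is determined solely by the coherent-interference term C and the desired-signal term A. -/

import Mathlib

open Finset Filter Topology

noncomputable section

/-- Fixed system parameters of the cell-free massive MIMO uplink:
`K` UEs, pilot length `τ`, pilot power `ρp`, noise power `σ2`,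
power-control coefficients `γ`, pilot correlations `δ` (δ k k' = |φ_k^H φ_{k'}|²),
and large-scale fading coefficients `β m k` (AP index `m ∈ ℕ`, UE index `k`). -/
structure Params where
  K : ℕ
  τ : ℕ
  ρp : ℝ
  σ2 : ℝ
  γ : Fin K → ℝ
  δ : Fin K → Fin K → ℝ
  β : ℕ → Fin K → ℝ

namespace Params

variable (P : Params)

/-- LMMSE coefficient `c_{mk}` for hardware quality factors `κt, κr`. -/
def c (κt κr : ℝ) (m : ℕ) (k : Fin P.K) : ℝ :=
  Real.sqrt ((P.τ : ℝ) * P.ρp * κr * κt) * P.β m k /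
    (P.ρp * ∑ k' : Fin P.K, P.β m k' *
      (κr * κt * (P.τ : ℝ) * P.δ k k' + (1 - κr * κt)) + P.σ2)

/-- Mean-square of the LMMSE channel estimate `λ_{mk}`. -/
def lam (κt κr : ℝ) (m : ℕ) (k : Fin P.K) : ℝ :=
  Real.sqrt ((P.τ : ℝ) * P.ρp * κr * κt) * P.β m k * P.c κt κr m k

/-- Desired-signal term `A_k` (using APs `0, …, M-1`). -/
def A (κt κr : ℝ) (M : ℕ) (k : Fin P.K) : ℝ :=
  P.γ k * (∑ m ∈ Finset.range M, P.lam κt κr m k) ^ 2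

/-- Non-coherent interference term `B_k`. -/
def B (κt κr : ℝ) (M : ℕ) (k : Fin P.K) : ℝ :=
  ∑ k' : Fin P.K, P.γ k' *
    ((∑ m ∈ Finset.range M, P.lam κt κr m k * P.β m k') +
      P.ρp * (1 - κr) * ∑ m ∈ Finset.range M, (P.c κt κr m k) ^ 2 * (P.β m k') ^ 2)

/-- Coherent interference term `C_k`. -/
def C (κt κr : ℝ) (M : ℕ) (k : Fin P.K) : ℝ :=
  ∑ k' : Fin P.K, P.γ k' * (P.δ k k' + (1 - κt) / (κt * (P.τ : ℝ))) *
    (∑ m ∈ Finset.range M, P.lam κt κr m k * (P.β m k' / P.β m k)) ^ 2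

/-- AP receiver-distortion term `D_k`. -/
def D (κt κr : ℝ) (M : ℕ) (k : Fin P.K) : ℝ :=
  ∑ m ∈ Finset.range M, ∑ k' : Fin P.K, P.γ k' *
    (P.lam κt κr m k * P.β m k' +
      (P.c κt κr m k) ^ 2 * (1 - κr) * P.ρp * (P.β m k') ^ 2 +
      (P.c κt κr m k) ^ 2 * κr * P.ρp * P.β m k' *
        ((P.τ : ℝ) * κt * P.δ k k' + (1 - κt)))

/-- Noise term `E_k` for uplink power `ρu`. -/
def E (κt κr ρu : ℝ) (M : ℕ) (k : Fin P.K) : ℝ :=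
  (P.σ2 / ρu) * ∑ m ∈ Finset.range M, P.lam κt κr m k

/-- Effective SINR of UE `k` (Theorem 1). -/
def SINR (κt κr ρu : ℝ) (M : ℕ) (k : Fin P.K) : ℝ :=
  κr * κt * P.A κt κr M k /
    (κr * P.B κt κr M k + κr * P.C κt κr M k - κr * κt * P.A κt κr M k +
      (1 - κr) * P.D κt κr M k + P.E κt κr ρu M k)

/-- Spectral efficiency of UE `k` (Theorem 1): `R_k = log₂(1 + SINR_k)`. -/
def R (κt κr ρu : ℝ) (M : ℕ) (k : Fin P.K) : ℝ :=
  Real.logb 2 (1 + P.SINR κt κr ρu M k)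

/-- Standing assumptions on the fixed parameters: `K ≥ 1`, `τ ≥ 1`, `ρp, σ² > 0`,
`γ_k ∈ (0,1]`, `δ_{kk'} ∈ [0,1]`, `δ_{kk} = 1`. -/
def Valid : Prop :=
  1 ≤ P.K ∧ 1 ≤ P.τ ∧ 0 < P.ρp ∧ 0 < P.σ2 ∧
  (∀ k, 0 < P.γ k ∧ P.γ k ≤ 1) ∧
  (∀ k k', 0 ≤ P.δ k k' ∧ P.δ k k' ≤ 1) ∧
  (∀ k, P.δ k k = 1)

end Params

lemma aux_den (P : Params) (hP : P.Valid) {βmin βmax : ℝ} (hβmin : 0 < βmin)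
    (hβ : ∀ m : ℕ, ∀ k : Fin P.K, βmin ≤ P.β m k ∧ P.β m k ≤ βmax)
    {κt : ℝ} (hκt : 0 < κt ∧ κt < 1) {κ : ℝ} (hκ : 0 < κ ∧ κ ≤ 1) (m : ℕ) (k : Fin P.K) :
    P.σ2 ≤ (P.ρp * ∑ k' : Fin P.K, P.β m k' *
      (κ * κt * (P.τ : ℝ) * P.δ k k' + (1 - κ * κt)) + P.σ2) ∧
    (P.ρp * ∑ k' : Fin P.K, P.β m k' *
      (κ * κt * (P.τ : ℝ) * P.δ k k' + (1 - κ * κt)) + P.σ2) ≤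
      P.ρp * (P.K * (βmax * (P.τ + 1))) + P.σ2 := by
  obtain ⟨hK, hτ, hρ, hσ, hγ, hδ, hδ1⟩ := hP
  have hτ' : (1 : ℝ) ≤ P.τ := by exact_mod_cast hτ
  have hx0 : 0 < κ * κt := mul_pos hκ.1 hκt.1
  have hx1 : κ * κt ≤ 1 := by nlinarith [hκ.1, hκ.2, hκt.1, hκt.2]
  have hterm0 : ∀ k', 0 ≤ P.β m k' * (κ * κt * (P.τ : ℝ) * P.δ k k' + (1 - κ * κt)) := by
    intro k'
    have h1 : 0 < P.β m k' := hβmin.trans_le (hβ m k').1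
    have h2 := (hδ k k').1
    have h3 : 0 ≤ κ * κt * (P.τ : ℝ) * P.δ k k' := by positivity
    exact mul_nonneg h1.le (by linarith)
  have hterm1 : ∀ k', P.β m k' * (κ * κt * (P.τ : ℝ) * P.δ k k' + (1 - κ * κt))
      ≤ βmax * (P.τ + 1) := by
    intro k'
    have h1 : 0 < P.β m k' := hβmin.trans_le (hβ m k').1
    have h2 := hδ k k'
    have h3 : κ * κt * (P.τ : ℝ) * P.δ k k' ≤ 1 * P.τ * 1 := by
      gcongr
      · exact h2.1
      · exact h2.2
    have h4 : 0 ≤ κ * κt * (P.τ : ℝ) * P.δ k k' := mul_nonneg (by positivity) h2.1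
    refine mul_le_mul (hβ m k').2 (by linarith) (by linarith) (h1.le.trans (hβ m k').2)
  constructor
  · have := mul_nonneg hρ.le (Finset.sum_nonneg fun k' (_ : k' ∈ Finset.univ) => hterm0 k')
    linarith
  · have h : ∑ k' : Fin P.K, P.β m k' * (κ * κt * (P.τ : ℝ) * P.δ k k' + (1 - κ * κt))
        ≤ P.K * (βmax * (P.τ + 1)) := by
      refine (Finset.sum_le_sum fun k' _ => hterm1 k').trans ?_
      simp
    have := mul_le_mul_of_nonneg_left h hρ.le
    linarith

lemma aux_lam (P : Params) (hP : P.Valid) {βmin βmax : ℝ} (hβmin : 0 < βmin)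
    (hβ : ∀ m : ℕ, ∀ k : Fin P.K, βmin ≤ P.β m k ∧ P.β m k ≤ βmax)
    {κt : ℝ} (hκt : 0 < κt ∧ κt < 1) (k : Fin P.K) :
    ∃ a b d : ℝ, 0 < a ∧ 0 < b ∧ 0 < d ∧ ∀ κ : ℝ, 0 < κ → κ ≤ 1 → ∀ m : ℕ,
      a * κ ≤ P.lam κt κ m k ∧ P.lam κt κ m k ≤ b * κ ∧ (P.c κt κ m k) ^ 2 ≤ d * κ := by
  have hP' := hP
  obtain ⟨hK, hτ, hρ, hσ, hγ, hδ, hδ1⟩ := hP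
  have hτ' : (0 : ℝ) < P.τ := by exact_mod_cast hτ
  have hβmax : 0 < βmax := hβmin.trans_le ((hβ 0 k).1.trans (hβ 0 k).2)
  have hκt0 := hκt.1
  refine ⟨(P.τ * P.ρp * κt) * βmin ^ 2 / (P.ρp * (P.K * (βmax * (P.τ + 1))) + P.σ2),
    (P.τ * P.ρp * κt) * βmax ^ 2 / P.σ2, (P.τ * P.ρp * κt) * βmax ^ 2 / P.σ2 ^ 2,
    by positivity, by positivity, by positivity, ?_⟩
  intro κ h0 h1 m
  obtain ⟨hd1, hd2⟩ := aux_den P hP' hβmin hβ hκt ⟨h0, h1⟩ m k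
  have hs : Real.sqrt ((P.τ : ℝ) * P.ρp * κ * κt) ^ 2 = (P.τ : ℝ) * P.ρp * κ * κt :=
    Real.sq_sqrt (by positivity)
  unfold Params.lam Params.c
  set den := (P.ρp * ∑ k' : Fin P.K, P.β m k' *
      (κ * κt * (P.τ : ℝ) * P.δ k k' + (1 - κ * κt)) + P.σ2) with hden
  set s := Real.sqrt ((P.τ : ℝ) * P.ρp * κ * κt) with hsdef
  have hden0 : 0 < den := hσ.trans_le hd1
  have e1 : s * P.β m k * (s * P.β m k / den) = (P.τ * P.ρp * κ * κt) * P.β m k ^ 2 / den := by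
    rw [← hs]; ring
  have e2 : (s * P.β m k / den) ^ 2 = (P.τ * P.ρp * κ * κt) * P.β m k ^ 2 / den ^ 2 := by
    rw [← hs]; ring
  have hb := hβ m k
  have hb0 : 0 < P.β m k := hβmin.trans_le hb.1
  rw [e1, e2]
  refine ⟨?_, ?_, ?_⟩
  · calc _ = (P.τ * P.ρp * κ * κt) * βmin ^ 2 /
          (P.ρp * (P.K * (βmax * (P.τ + 1))) + P.σ2) := by ring
      _ ≤ _ := by gcongr; exact hb.1
  · calc _ ≤ (P.τ * P.ρp * κ * κt) * βmax ^ 2 / P.σ2 := by gcongr; exact hb.2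
      _ = _ := by ring
  · calc _ ≤ (P.τ * P.ρp * κ * κt) * βmax ^ 2 / P.σ2 ^ 2 := by gcongr; exact hb.2
      _ = _ := by ring

lemma aux_BDE (P : Params) (hP : P.Valid) {βmin βmax : ℝ} (hβmin : 0 < βmin)
    (hβ : ∀ m : ℕ, ∀ k : Fin P.K, βmin ≤ P.β m k ∧ P.β m k ≤ βmax)
    {κt : ℝ} (hκt : 0 < κt ∧ κt < 1) {ρu : ℝ} (hρu : 0 < ρu) (k : Fin P.K) :
    ∃ a L : ℝ, 0 < a ∧ 0 < L ∧ ∀ κ : ℝ, 0 < κ → κ ≤ 1 → ∀ M : ℕ,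
      a * κ * M ≤ ∑ m ∈ Finset.range M, P.lam κt κ m k ∧
      0 ≤ κ * P.B κt κ M k + (1 - κ) * P.D κt κ M k + P.E κt κ ρu M k ∧
      κ * P.B κt κ M k + (1 - κ) * P.D κt κ M k + P.E κt κ ρu M k ≤ L * κ * M := by
  obtain ⟨a, b, d, ha, hb, hd, H⟩ := aux_lam P hP hβmin hβ hκt k
  obtain ⟨hK, hτ, hρ, hσ, hγ, hδ, hδ1⟩ := hP
  have hτ' : (0 : ℝ) < P.τ := by exact_mod_cast hτ
  have hK' : (0 : ℝ) < P.K := by exact_mod_cast hK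
  have hβmax : 0 < βmax := hβmin.trans_le ((hβ 0 k).1.trans (hβ 0 k).2)
  have hκt0 := hκt.1
  have hκt1 := hκt.2
  have hβ0 : ∀ m k', 0 < P.β m k' := fun m k' => hβmin.trans_le (hβ m k').1
  refine ⟨a, P.K * (b * βmax + P.ρp * d * βmax ^ 2) + P.K * (b * βmax + d * P.ρp * βmax ^ 2
    + d * P.ρp * βmax * (P.τ + 1)) + P.σ2 / ρu * b, ha, by positivity, ?_⟩
  intro κ h0 h1 M
  have hM : (0 : ℝ) ≤ M := Nat.cast_nonneg M
  have hl0 : ∀ m, 0 ≤ P.lam κt κ m k := fun m => le_trans (by positivity) (H κ h0 h1 m).1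
  have hl1 : ∀ m, P.lam κt κ m k ≤ b * κ := fun m => (H κ h0 h1 m).2.1
  have hc1 : ∀ m, P.c κt κ m k ^ 2 ≤ d * κ := fun m => (H κ h0 h1 m).2.2
  have h1κ : 0 ≤ 1 - κ := by linarith
  have hS0 : 0 ≤ ∑ m ∈ Finset.range M, P.lam κt κ m k := Finset.sum_nonneg fun m _ => hl0 m
  have hSb : ∑ m ∈ Finset.range M, P.lam κt κ m k ≤ M * (b * κ) := by
    refine (Finset.sum_le_sum fun m _ => hl1 m).trans ?_
    simp
  have hB0 : 0 ≤ P.B κt κ M k := by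
    refine Finset.sum_nonneg fun k' _ => mul_nonneg (hγ k').1.le (add_nonneg ?_ ?_)
    · exact Finset.sum_nonneg fun m _ => mul_nonneg (hl0 m) (hβ0 m k').le
    · exact mul_nonneg (mul_nonneg hρ.le h1κ) (Finset.sum_nonneg fun m _ => by positivity)
  have hB1 : P.B κt κ M k ≤ P.K * (b * βmax + P.ρp * d * βmax ^ 2) * κ * M := by
    have key : ∀ k', P.γ k' * ((∑ m ∈ Finset.range M, P.lam κt κ m k * P.β m k') +
      P.ρp * (1 - κ) * ∑ m ∈ Finset.range M, (P.c κt κ m k) ^ 2 * (P.β m k') ^ 2) ≤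
      (b * βmax + P.ρp * d * βmax ^ 2) * κ * M := by
      intro k'
      have t1 : ∑ m ∈ Finset.range M, P.lam κt κ m k * P.β m k' ≤ M * (b * κ * βmax) := by
        refine (Finset.sum_le_sum fun m _ => mul_le_mul (hl1 m) (hβ m k').2 (hβ0 m k').le
          (by positivity)).trans ?_
        simp
      have t1' : 0 ≤ ∑ m ∈ Finset.range M, P.lam κt κ m k * P.β m k' :=
        Finset.sum_nonneg fun m _ => mul_nonneg (hl0 m) (hβ0 m k').le
      have t2 : ∑ m ∈ Finset.range M, (P.c κt κ m k) ^ 2 * (P.β m k') ^ 2 ≤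
          M * (d * κ * βmax ^ 2) := by
        refine (Finset.sum_le_sum fun m _ => mul_le_mul (hc1 m)
          (pow_le_pow_left₀ (hβ0 m k').le (hβ m k').2 2) (by positivity)
          (by positivity)).trans ?_
        simp
      have t2' : 0 ≤ ∑ m ∈ Finset.range M, (P.c κt κ m k) ^ 2 * (P.β m k') ^ 2 :=
        Finset.sum_nonneg fun m _ => by positivity
      have t3 : P.ρp * (1 - κ) * ∑ m ∈ Finset.range M, (P.c κt κ m k) ^ 2 * (P.β m k') ^ 2
          ≤ P.ρp * 1 * (M * (d * κ * βmax ^ 2)) := by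
        gcongr
        linarith
      have t3' : 0 ≤ P.ρp * (1 - κ) * ∑ m ∈ Finset.range M, (P.c κt κ m k) ^ 2 * (P.β m k') ^ 2 :=
        mul_nonneg (mul_nonneg hρ.le h1κ) t2'
      calc _ ≤ 1 * (M * (b * κ * βmax) + P.ρp * 1 * (M * (d * κ * βmax ^ 2))) :=
            mul_le_mul (hγ k').2 (add_le_add t1 t3) (add_nonneg t1' t3') zero_le_one
        _ = _ := by ring
    refine (Finset.sum_le_sum fun k' _ => key k').trans (le_of_eq ?_)
    simp; ring
  have hF0 : ∀ k', 0 ≤ ((P.τ : ℝ) * κt * P.δ k k' + (1 - κt)) := by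
    intro k'
    have := mul_nonneg (mul_pos hτ' hκt0).le (hδ k k').1
    linarith
  have hF1 : ∀ k', ((P.τ : ℝ) * κt * P.δ k k' + (1 - κt)) ≤ P.τ + 1 := by
    intro k'
    have : (P.τ : ℝ) * κt * P.δ k k' ≤ P.τ * 1 * 1 := by
      gcongr
      · exact (hδ k k').1
      · exact (hδ k k').2
    linarith
  have hT0 : ∀ m k', 0 ≤ (P.lam κt κ m k * P.β m k' +
      (P.c κt κ m k) ^ 2 * (1 - κ) * P.ρp * (P.β m k') ^ 2 +
      (P.c κt κ m k) ^ 2 * κ * P.ρp * P.β m k' *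
        ((P.τ : ℝ) * κt * P.δ k k' + (1 - κt))) := by
    intro m k'
    have := hF0 k'
    have := hl0 m
    have := hβ0 m k'
    positivity
  have hD0 : 0 ≤ P.D κt κ M k :=
    Finset.sum_nonneg fun m _ => Finset.sum_nonneg fun k' _ =>
      mul_nonneg (hγ k').1.le (hT0 m k')
  have hD1 : P.D κt κ M k ≤ P.K * (b * βmax + d * P.ρp * βmax ^ 2
    + d * P.ρp * βmax * (P.τ + 1)) * κ * M := by
    have key : ∀ m k', P.γ k' * (P.lam κt κ m k * P.β m k' +
      (P.c κt κ m k) ^ 2 * (1 - κ) * P.ρp * (P.β m k') ^ 2 +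
      (P.c κt κ m k) ^ 2 * κ * P.ρp * P.β m k' *
        ((P.τ : ℝ) * κt * P.δ k k' + (1 - κt))) ≤ (b * βmax + d * P.ρp * βmax ^ 2
        + d * P.ρp * βmax * (P.τ + 1)) * κ := by
      intro m k'
      have g0 := hF0 k'
      have g1 := hF1 k'
      have g2 := hl0 m
      have g3 := hl1 m
      have g4 := hβ0 m k'
      have g5 := (hβ m k').2
      have g6 := hc1 m
      have g7 : 1 - κ ≤ 1 := by linarith
      calc _ ≤ 1 * ((b * κ) * βmax + (d * κ) * 1 * P.ρp * βmax ^ 2 +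
            (d * κ) * 1 * P.ρp * βmax * (P.τ + 1)) := by
            refine mul_le_mul (hγ k').2 ?_ (hT0 m k') zero_le_one
            gcongr
        _ = _ := by ring
    refine (Finset.sum_le_sum fun m _ => Finset.sum_le_sum fun k' _ => key m k').trans
      (le_of_eq ?_)
    simp; ring
  have hE0 : 0 ≤ P.E κt κ ρu M k := mul_nonneg (by positivity) hS0
  have hE1 : P.E κt κ ρu M k ≤ P.σ2 / ρu * b * κ * M := by
    calc P.E κt κ ρu M k ≤ P.σ2 / ρu * (M * (b * κ)) :=
          mul_le_mul_of_nonneg_left hSb (by positivity)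
      _ = _ := by ring
  refine ⟨?_, ?_, ?_⟩
  · calc a * κ * M = ∑ m ∈ Finset.range M, a * κ := by simp; ring
      _ ≤ _ := Finset.sum_le_sum fun m _ => (H κ h0 h1 m).1
  · have := mul_nonneg h0.le hB0
    have := mul_nonneg h1κ hD0
    linarith
  · have i1 : κ * P.B κt κ M k ≤ P.B κt κ M k := mul_le_of_le_one_left hB0 h1
    have i2 : (1 - κ) * P.D κt κ M k ≤ P.D κt κ M k :=
      mul_le_of_le_one_left hD0 (by linarith)
    calc _ ≤ _ := add_le_add (add_le_add (i1.trans hB1) (i2.trans hD1)) hE1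
      _ = _ := by ring

lemma aux_C (P : Params) (hP : P.Valid) {βmin βmax : ℝ} (hβmin : 0 < βmin)
    (hβ : ∀ m : ℕ, ∀ k : Fin P.K, βmin ≤ P.β m k ∧ P.β m k ≤ βmax)
    {κt : ℝ} (hκt : 0 < κt ∧ κt < 1) (k : Fin P.K) (κ : ℝ) (M : ℕ)
    (hA : 0 < P.A κt κ M k) :
    1 / κt - 1 ≤ P.C κt κ M k / (κt * P.A κt κ M k) - 1 := by
  obtain ⟨hK, hτ, hρ, hσ, hγ, hδ, hδ1⟩ := hP
  have hτ' : (0 : ℝ) < P.τ := by exact_mod_cast hτ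
  have hκt0 := hκt.1
  have hu : 0 ≤ (1 - κt) / (κt * (P.τ : ℝ)) := div_nonneg (by linarith [hκt.2]) (by positivity)
  have hC : P.A κt κ M k ≤ P.C κt κ M k := by
    have h1 := Finset.single_le_sum (f := fun k' : Fin P.K =>
      P.γ k' * (P.δ k k' + (1 - κt) / (κt * (P.τ : ℝ))) *
      (∑ m ∈ Finset.range M, P.lam κt κ m k * (P.β m k' / P.β m k)) ^ 2)
      (fun k' _ => mul_nonneg (mul_nonneg (hγ k').1.le (add_nonneg (hδ k k').1 hu))
        (sq_nonneg _)) (Finset.mem_univ k)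
    refine le_trans ?_ h1
    have e : ∀ m, P.β m k / P.β m k = 1 := fun m =>
      div_self (hβmin.trans_le (hβ m k).1).ne'
    simp only [e, mul_one, hδ1]
    unfold Params.A
    refine mul_le_mul_of_nonneg_right ?_ (sq_nonneg _)
    exact le_mul_of_one_le_right (hγ k).1.le (by linarith)
  have : 1 / κt ≤ P.C κt κ M k / (κt * P.A κt κ M k) := by
    rw [div_le_div_iff₀ hκt0 (by positivity)]
    nlinarith
  linarith

lemma aux_log {X Y ε : ℝ} (hε : 0 < ε) (hX : ε ≤ X) (hY : 0 ≤ Y) :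
    |Real.logb 2 (1 + (X + Y)⁻¹) - Real.logb 2 (1 + X⁻¹)| ≤ Y / ε ^ 2 / Real.log 2 := by
  have hX0 : 0 < X := hε.trans_le hX
  have hl2 : 0 < Real.log 2 := Real.log_pos one_lt_two
  have p1 : 0 < 1 + (X + Y)⁻¹ := by positivity
  have p2 : 0 < 1 + X⁻¹ := by positivity
  have hle : (X + Y)⁻¹ ≤ X⁻¹ := inv_anti₀ hX0 (by linarith)
  have hmono : Real.log (1 + (X + Y)⁻¹) ≤ Real.log (1 + X⁻¹) :=
    Real.log_le_log p1 (by linarith)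
  unfold Real.logb
  rw [← sub_div, abs_div, abs_of_pos hl2, abs_sub_comm, abs_of_nonneg (by linarith)]
  gcongr
  rw [← Real.log_div p2.ne' p1.ne']
  refine (Real.log_le_sub_one_of_pos (by positivity)).trans ?_
  have e : (1 + X⁻¹) / (1 + (X + Y)⁻¹) - 1 = Y / (X * (X + Y + 1)) := by
    field_simp
    ring
  rw [e]
  gcongr
  rw [sq]
  exact mul_le_mul hX (by linarith) hε.le hX0.le

/-- Corollary 1, convergent case: with `z_t = 0`, `0 < z_r < 1/2` and `κ_{t0} < 1`,
for every UE `k` the quantity `C_k(M)/(κ_{t0} A_k(M)) − 1` is strictly positive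
for every `M ≥ 1`, and `R_k(M) − log₂(1 + (C_k(M)/(κ_{t0} A_k(M)) − 1)⁻¹) → 0`
as `M → ∞`. -/
theorem hardware_scaling_law_convergent_case
    (P : Params) (hP : P.Valid) (ρu : ℝ) (hρu : 0 < ρu)
    (βmin βmax : ℝ) (hβmin : 0 < βmin)
    (hβ : ∀ m : ℕ, ∀ k : Fin P.K, βmin ≤ P.β m k ∧ P.β m k ≤ βmax)
    (κt0 κr0 : ℝ) (hκt0 : 0 < κt0 ∧ κt0 < 1) (hκr0 : 0 < κr0 ∧ κr0 ≤ 1)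
    (zr : ℝ) (hzr : 0 < zr ∧ zr < 1 / 2) (k : Fin P.K) :
    (∀ M : ℕ, 1 ≤ M →
      0 < P.C κt0 (κr0 / (M : ℝ) ^ zr) M k /
            (κt0 * P.A κt0 (κr0 / (M : ℝ) ^ zr) M k) - 1) ∧
    Filter.Tendsto
      (fun M : ℕ =>
        P.R κt0 (κr0 / (M : ℝ) ^ zr) ρu M k -
          Real.logb 2 (1 +
            (P.C κt0 (κr0 / (M : ℝ) ^ zr) M k /
              (κt0 * P.A κt0 (κr0 / (M : ℝ) ^ zr) M k) - 1)⁻¹))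
      Filter.atTop (nhds 0) := by
  have hκpos : ∀ M : ℕ, 1 ≤ M → 0 < κr0 / (M : ℝ) ^ zr ∧ κr0 / (M : ℝ) ^ zr ≤ 1 := by
    intro M hM
    have hM1 : (1 : ℝ) ≤ M := by exact_mod_cast hM
    have h1 : (1 : ℝ) ≤ (M : ℝ) ^ zr := Real.one_le_rpow hM1 hzr.1.le
    have := hκr0.1
    refine ⟨by positivity, ?_⟩
    rw [div_le_one (by positivity)]
    linarith [hκr0.2]
  obtain ⟨a, L, ha, hL, H⟩ := aux_BDE P hP hβmin hβ hκt0 hρu k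
  have hγ : 0 < P.γ k := (hP.2.2.2.2.1 k).1
  have hA1 : ∀ M : ℕ, 1 ≤ M → P.γ k * (a * (κr0 / (M : ℝ) ^ zr) * M) ^ 2 ≤
      P.A κt0 (κr0 / (M : ℝ) ^ zr) M k := by
    intro M hM
    obtain ⟨h0, h1⟩ := hκpos M hM
    exact mul_le_mul_of_nonneg_left
      (pow_le_pow_left₀ (by positivity) (H _ h0 h1 M).1 2) hγ.le
  have hA0 : ∀ M : ℕ, 1 ≤ M → 0 < P.A κt0 (κr0 / (M : ℝ) ^ zr) M k := by
    intro M hM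
    obtain ⟨h0, h1⟩ := hκpos M hM
    have hM1 : (0 : ℝ) < M := by exact_mod_cast hM
    exact lt_of_lt_of_le (by positivity) (hA1 M hM)
  have hε : 0 < 1 / κt0 - 1 := by
    have := one_lt_one_div hκt0.1 hκt0.2
    linarith
  have hX : ∀ M : ℕ, 1 ≤ M → 1 / κt0 - 1 ≤ P.C κt0 (κr0 / (M : ℝ) ^ zr) M k /
            (κt0 * P.A κt0 (κr0 / (M : ℝ) ^ zr) M k) - 1 := fun M hM =>
    aux_C P hP hβmin hβ hκt0 k _ M (hA0 M hM)
  refine ⟨fun M hM => hε.trans_le (hX M hM), ?_⟩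
  have ht0 := hκt0.1
  have hr0 := hκr0.1
  set W : ℝ := L / (κt0 * P.γ k * a ^ 2 * κr0 ^ 2) with hW
  have hlim : Filter.Tendsto (fun M : ℕ => W * (M : ℝ) ^ (-(1 - 2 * zr)) /
      (1 / κt0 - 1) ^ 2 / Real.log 2) Filter.atTop (nhds 0) := by
    have h1 := (tendsto_rpow_neg_atTop (y := 1 - 2 * zr) (by linarith [hzr.2])).comp
      (tendsto_natCast_atTop_atTop (R := ℝ))
    have h2 := ((h1.const_mul W).div_const ((1 / κt0 - 1) ^ 2)).div_const (Real.log 2)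
    simpa using h2
  refine squeeze_zero_norm' ?_ hlim
  filter_upwards [Filter.eventually_ge_atTop 1] with M hM
  obtain ⟨h0, h1⟩ := hκpos M hM
  have hA := hA0 M hM
  have hA' := hA1 M hM
  have hX' := hX M hM
  obtain ⟨-, hN0, hN1⟩ := H _ h0 h1 M
  have hM1 : (0 : ℝ) < M := by exact_mod_cast hM
  have hpow : (0 : ℝ) < (M : ℝ) ^ zr := by positivity
  have hMp : (M : ℝ) ^ (-(1 - 2 * zr)) = ((M : ℝ) ^ zr) ^ 2 / M := by
    rw [show -(1 - 2 * zr) = zr + zr - 1 by ring, Real.rpow_sub_one hM1.ne',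
      Real.rpow_add hM1, sq]
  rw [hMp]
  unfold Params.R Params.SINR
  set q := (M : ℝ) ^ zr with hq
  set κ := κr0 / q with hκ
  set N := κ * P.B κt0 κ M k + (1 - κ) * P.D κt0 κ M k + P.E κt0 κ ρu M k with hN
  set A := P.A κt0 κ M k with hAdef
  set C := P.C κt0 κ M k with hCdef
  have hY0 : 0 ≤ N / (κ * κt0 * A) := by positivity
  have hY1 : N / (κ * κt0 * A) ≤ W * (q ^ 2 / M) := by
    calc N / (κ * κt0 * A) ≤ (L * κ * M) / (κ * κt0 * (P.γ k * (a * κ * M) ^ 2)) := by gcongr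
      _ = W * (q ^ 2 / M) := by
        rw [hW, hκ]
        field_simp
  have e : κ * κt0 * A / (κ * P.B κt0 κ M k + κ * C - κ * κt0 * A +
      (1 - κ) * P.D κt0 κ M k + P.E κt0 κ ρu M k) =
      ((C / (κt0 * A) - 1) + N / (κ * κt0 * A))⁻¹ := by
    have : (C / (κt0 * A) - 1) + N / (κ * κt0 * A) =
        (κ * P.B κt0 κ M k + κ * C - κ * κt0 * A +
      (1 - κ) * P.D κt0 κ M k + P.E κt0 κ ρu M k) / (κ * κt0 * A) := by
      have : κ * P.B κt0 κ M k + κ * C - κ * κt0 * A +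
        (1 - κ) * P.D κt0 κ M k + P.E κt0 κ ρu M k = κ * C - κ * κt0 * A + N := by
        rw [hN]; ring
      rw [this]
      field_simp
    rw [this, inv_div]
  rw [e, Real.norm_eq_abs]
  refine (aux_log hε hX' hY0).trans ?_
  have hl2 : 0 < Real.log 2 := Real.log_pos one_lt_two
  gcongr
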